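/- Suppose the sign of the edge {u,v} is flipped from + to −, and suppose w is adjacent to u in G⁺ but u and w are not in ε-agreement in G⁺ (i.e., NonAgreement_{G⁺}(u,w) ≥ ε). If either (a) w ∈ N_{G⁺}(u) ∩ N_{G⁺}(v), or (b) w ∈ N_{G⁺}(u) \ N_{G⁺}(v), w ≠ v, |N_{G⁺}(u)| > |N_{G⁺}(w)|, and |N_{G⁺}(u) Δ N_{G⁺}(w)| > |N_{G⁺}(u)|, then u and w are not in ε-agreement in H⁺. -/

import Mathlib

open SimpleGraph

/-- `NonAgreement G x y = |N_G(x) Δ N_G(y)| / max(|N_G(x)|, |N_G(y)|)` as a rational number. -/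
noncomputable def NonAgreement {V : Type*} [Fintype V] (G : SimpleGraph V) (x y : V) : ℚ :=
  ((symmDiff (G.neighborSet x) (G.neighborSet y)).ncard : ℚ) /
    ((max (G.neighborSet x).ncard (G.neighborSet y).ncard : ℕ) : ℚ)

/-- Vertices `x` and `y` are in `ε`-agreement in `G` if they are adjacent
and `NonAgreement G x y < ε`. -/
def EpsAgree {V : Type*} [Fintype V] (ε : ℚ) (G : SimpleGraph V) (x y : V) : Prop :=
  G.Adj x y ∧ NonAgreement G x y < ε

theorem SimpleGraph.neighborSet_deleteEdges_singleton_left {V : Type*} (G : SimpleGraph V)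
    (u v : V) : (G.deleteEdges {s(u, v)}).neighborSet u = G.neighborSet u \ {v} := by
  ext x
  simp only [mem_neighborSet, deleteEdges_adj, Set.mem_singleton_iff, Set.mem_sdiff,
    Sym2.congr_right]

theorem SimpleGraph.neighborSet_deleteEdges_singleton_of_ne {V : Type*} (G : SimpleGraph V)
    {u v w : V} (hu : w ≠ u) (hv : w ≠ v) :
    (G.deleteEdges {s(u, v)}).neighborSet w = G.neighborSet w := by
  ext x
  simp [hu, hv]

theorem Set.symmDiff_diff_singleton_of_mem {α : Type*} {s t : Set α} {a : α}
    (hs : a ∈ s) (ht : a ∈ t) : symmDiff (s \ {a}) t = insert a (symmDiff s t) := by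
  ext x
  by_cases hx : x = a <;> simp_all [Set.mem_symmDiff]

theorem Set.symmDiff_diff_singleton_of_notMem {α : Type*} {s t : Set α} {a : α}
    (ht : a ∉ t) : symmDiff (s \ {a}) t = symmDiff s t \ {a} := by
  ext x
  by_cases hx : x = a <;> simp_all [Set.mem_symmDiff]

/-- Lowering numerator and denominator by one does not decrease a fraction that is at least `1`. -/
theorem div_le_sub_one_div_sub_one {K : Type*} [Field K] [LinearOrder K] [IsStrictOrderedRing K]
    {a b : K} (hb : 1 < b) (hab : b ≤ a) : a / b ≤ (a - 1) / (b - 1) := by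
  rw [div_le_div_iff₀ (by linarith) (by linarith)]
  linarith

/-- Deleting an edge from `u` to a neighbor of `w` does not decrease the non-agreement of
`u` and `w`. -/
theorem nonAgreement_le_deleteEdges_of_adj {V : Type*} [Fintype V] {G : SimpleGraph V}
    {u v w : V} (huv : G.Adj u v) (huw : G.Adj u w) (hvw : G.Adj v w) :
    NonAgreement G u w ≤ NonAgreement (G.deleteEdges {s(u, v)}) u w := by
  have hw : 0 < (G.neighborSet w).ncard := (Set.ncard_pos).2 ⟨u, huw.symm⟩
  have hmem : v ∈ G.neighborSet u := huv
  have hmem' : v ∈ G.neighborSet w := hvw.symm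
  unfold NonAgreement
  rw [G.neighborSet_deleteEdges_singleton_left,
    G.neighborSet_deleteEdges_singleton_of_ne huw.ne' hvw.ne',
    Set.symmDiff_diff_singleton_of_mem hmem hmem']
  gcongr
  · exact Set.toFinite _
  · exact Set.subset_insert _ _
  · exact Set.toFinite _
  · exact Set.sdiff_subset

/-- Deleting an edge from `u` to a non-neighbor `v ≠ w` of `w` does not decrease the non-agreement
of `u` and `w`, provided `u` has larger degree than `w` and the non-agreement is at least `1`. -/
theorem nonAgreement_le_deleteEdges_of_not_adj {V : Type*} [Fintype V] {G : SimpleGraph V}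
    {u v w : V} (huv : G.Adj u v) (huw : G.Adj u w) (hvw : ¬ G.Adj v w) (hne : w ≠ v)
    (hlt : (G.neighborSet w).ncard < (G.neighborSet u).ncard)
    (hle : (G.neighborSet u).ncard ≤ (symmDiff (G.neighborSet u) (G.neighborSet w)).ncard) :
    NonAgreement G u w ≤ NonAgreement (G.deleteEdges {s(u, v)}) u w := by
  have hw : 0 < (G.neighborSet w).ncard := (Set.ncard_pos).2 ⟨u, huw.symm⟩
  have hmem : v ∈ G.neighborSet u := huv
  have hnotMem : v ∉ G.neighborSet w := fun h => hvw h.symm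
  have hsymm : v ∈ symmDiff (G.neighborSet u) (G.neighborSet w) := Or.inl ⟨hmem, hnotMem⟩
  unfold NonAgreement
  rw [G.neighborSet_deleteEdges_singleton_left,
    G.neighborSet_deleteEdges_singleton_of_ne huw.ne' hne,
    Set.symmDiff_diff_singleton_of_notMem hnotMem,
    Set.ncard_sdiff_singleton_of_mem hmem, Set.ncard_sdiff_singleton_of_mem hsymm,
    max_eq_left hlt.le, max_eq_left (by omega), Nat.cast_pred (by omega),
    Nat.cast_pred (by omega)]
  exact div_le_sub_one_div_sub_one (by exact_mod_cast (by omega)) (by exact_mod_cast hle)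

theorem stmt17 {V : Type*} [Fintype V] (G H : SimpleGraph V) (u v w : V) (ε : ℚ) (hε : 0 < ε)
    (huv : u ≠ v) (hadj : G.Adj u v)
    (hH : H = G.deleteEdges {s(u, v)})
    (hadjw : G.Adj u w) (hnagree : NonAgreement G u w ≥ ε)
    (hcase : (w ∈ G.neighborSet u ∩ G.neighborSet v) ∨
      (w ∈ G.neighborSet u \ G.neighborSet v ∧ w ≠ v ∧
        (G.neighborSet u).ncard > (G.neighborSet w).ncard ∧
        (symmDiff (G.neighborSet u) (G.neighborSet w)).ncard > (G.neighborSet u).ncard)) :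
    ¬ EpsAgree ε H u w := by
  subst hH
  rintro ⟨-, hlt⟩
  refine (hnagree.trans ?_).not_gt hlt
  rcases hcase with ⟨-, hvw⟩ | ⟨⟨-, hvw⟩, hne, hdeg, hsymm⟩
  · exact nonAgreement_le_deleteEdges_of_adj hadj hadjw hvw
  · exact nonAgreement_le_deleteEdges_of_not_adj hadj hadjw hvw hne hdeg hsymm.le
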